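/- For every g ∈ 𝒴 satisfying the orthogonality condition ∫_ℝ g(x) Q(x) dx = 0, there exists f ∈ 𝒴 such that L₋f = g, i.e. −f''(x) + f(x) − Q(x)^4 f(x) = g(x) for all x ∈ ℝ. -/

import Mathlib

open Real MeasureTheory

/-- The ground state `Q x = 3^(1/4) (sech (2x))^(1/2)`. -/
noncomputable def Q (x : ℝ) : ℝ :=
  (3 : ℝ) ^ ((1 : ℝ) / 4) * (1 / Real.cosh (2 * x)) ^ ((1 : ℝ) / 2)

/-- The class `𝒴`: even, smooth functions all of whose derivatives are bounded by
`C (1+|x|)^κ Q(x)`. -/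
def MemY (f : ℝ → ℝ) : Prop :=
  (∀ x : ℝ, f (-x) = f x) ∧ ContDiff ℝ (⊤ : ℕ∞) f ∧
    ∀ k : ℕ, ∃ C κ : ℝ, 0 < C ∧ 0 < κ ∧
      ∀ x : ℝ, |iteratedDeriv k f x| ≤ C * (1 + |x|) ^ κ * Q x

section GroundState

/-- The logarithmic derivative of `1 / Q`, that is `tanh (2x)`. -/
noncomputable def tanhTwo (x : ℝ) : ℝ := sinh (2 * x) / cosh (2 * x)

lemma Q_pos (x : ℝ) : 0 < Q x := by
  have := cosh_pos (2 * x)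
  unfold Q
  positivity

lemma Q_neg (x : ℝ) : Q (-x) = Q x := by
  simp [Q]

lemma Q_sq (x : ℝ) : Q x ^ 2 = √3 / cosh (2 * x) := by
  have h := cosh_pos (2 * x)
  have h1 : ((3 : ℝ) ^ ((1 : ℝ) / 4)) ^ 2 = √3 := by
    rw [← rpow_natCast, ← rpow_mul (by norm_num), sqrt_eq_rpow]
    norm_num
  have h2 : ((1 / cosh (2 * x)) ^ ((1 : ℝ) / 2)) ^ 2 = 1 / cosh (2 * x) := by
    rw [← sqrt_eq_rpow, sq_sqrt (by positivity)]
  rw [Q, mul_pow, h1, h2]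
  ring

lemma Q_pow_four (x : ℝ) : Q x ^ 4 = 3 * (1 - tanhTwo x ^ 2) := by
  have h := cosh_pos (2 * x)
  have h3 : √3 ^ 2 = (3 : ℝ) := sq_sqrt (by norm_num)
  have h4 : Q x ^ 4 = (Q x ^ 2) ^ 2 := by ring
  rw [h4, Q_sq, tanhTwo, div_pow, h3, div_pow, sinh_sq]
  field_simp
  ring

lemma abs_tanhTwo_le_one (x : ℝ) : |tanhTwo x| ≤ 1 := by
  have h : 0 < Q x ^ 4 := pow_pos (Q_pos x) 4
  rw [Q_pow_four] at h
  rw [← sq_le_one_iff_abs_le_one]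
  linarith

lemma hasDerivAt_tanhTwo (x : ℝ) : HasDerivAt tanhTwo (2 * (1 - tanhTwo x * tanhTwo x)) x := by
  have h := (cosh_pos (2 * x)).ne'
  have hl : HasDerivAt (fun y : ℝ => 2 * y) 2 x := by
    simpa using (hasDerivAt_id x).const_mul 2
  have := hl.sinh.div hl.cosh h
  refine this.congr_deriv ?_
  unfold tanhTwo
  field_simp

lemma hasDerivAt_Q (x : ℝ) : HasDerivAt Q (-(tanhTwo x * Q x)) x := by
  have h := cosh_pos (2 * x)
  have hl : HasDerivAt (fun y : ℝ => 2 * y) 2 x := by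
    simpa using (hasDerivAt_id x).const_mul 2
  have hd := ((hl.cosh.fun_inv h.ne').rpow_const (p := (1 : ℝ) / 2)
    (Or.inl (inv_pos.2 h).ne')).const_mul ((3 : ℝ) ^ ((1 : ℝ) / 4))
  have hQ : Q = fun y => (3 : ℝ) ^ ((1 : ℝ) / 4) * ((cosh (2 * y))⁻¹) ^ ((1 : ℝ) / 2) := by
    ext y
    simp [Q]
  rw [hQ]
  refine hd.congr_deriv ?_
  rw [rpow_sub_one (inv_pos.2 h).ne']
  simp only [tanhTwo]
  field_simp

lemma differentiable_Q : Differentiable ℝ Q := fun x => (hasDerivAt_Q x).differentiableAt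

lemma Q_sq_le (x : ℝ) : Q x ^ 2 ≤ √3 * 2 * exp (-2 * x) := by
  have h := cosh_pos (2 * x)
  rw [Q_sq, div_le_iff₀ h, cosh_eq]
  have h1 : exp (-2 * x) * exp (2 * x) = 1 := by rw [← exp_add]; simp
  have h2 := exp_pos (-2 * x)
  have h3 := exp_pos (-(2 * x))
  have : √3 * 2 * exp (-2 * x) * ((exp (2 * x) + exp (-(2 * x))) / 2)
      = √3 * (exp (-2 * x) * exp (2 * x)) + √3 * exp (-2 * x) * exp (-(2 * x)) := by ring
  rw [this, h1, mul_one]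
  have : 0 ≤ √3 * exp (-2 * x) * exp (-(2 * x)) := by positivity
  linarith

lemma exp_le_Q_sq {x : ℝ} (hx : 0 ≤ x) : exp (-2 * x) ≤ Q x ^ 2 := by
  have h := cosh_pos (2 * x)
  rw [Q_sq, le_div_iff₀ h, cosh_eq]
  have h1 : exp (-2 * x) * exp (2 * x) = 1 := by rw [← exp_add]; simp
  have h2 : exp (-(2 * x)) ≤ 1 := exp_le_one_iff.2 (by linarith)
  have h4 : exp (-2 * x) ≤ 1 := exp_le_one_iff.2 (by linarith)
  have h5 : (1 : ℝ) ≤ √3 := one_le_sqrt.2 (by norm_num)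
  have := exp_pos (-2 * x)
  have := exp_pos (-(2 * x))
  nlinarith

end GroundState

section PolynomialGrowth

/-- `u` is bounded by a polynomial in `|x|`. -/
def PolyBounded (u : ℝ → ℝ) : Prop := ∃ (C : ℝ) (k : ℕ), 0 ≤ C ∧ ∀ x, |u x| ≤ C * (1 + |x|) ^ k

lemma PolyBounded.add {u v : ℝ → ℝ} (hu : PolyBounded u) (hv : PolyBounded v) :
    PolyBounded (fun x => u x + v x) := by
  obtain ⟨C, k, hC, h⟩ := hu
  obtain ⟨D, l, hD, h'⟩ := hv
  refine ⟨C + D, k + l, by positivity, fun x => (abs_add_le _ _).trans ?_⟩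
  have h1 : (1 : ℝ) ≤ 1 + |x| := by linarith [abs_nonneg x]
  have hk : (1 + |x|) ^ k ≤ (1 + |x|) ^ (k + l) := pow_le_pow_right₀ h1 (by omega)
  have hl : (1 + |x|) ^ l ≤ (1 + |x|) ^ (k + l) := pow_le_pow_right₀ h1 (by omega)
  calc |u x| + |v x| ≤ C * (1 + |x|) ^ (k + l) + D * (1 + |x|) ^ (k + l) :=
        add_le_add ((h x).trans (by gcongr)) ((h' x).trans (by gcongr))
    _ = _ := by ring

lemma PolyBounded.mul {u v : ℝ → ℝ} (hu : PolyBounded u) (hv : PolyBounded v) :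
    PolyBounded (fun x => u x * v x) := by
  obtain ⟨C, k, hC, h⟩ := hu
  obtain ⟨D, l, hD, h'⟩ := hv
  refine ⟨C * D, k + l, by positivity, fun x => ?_⟩
  rw [abs_mul]
  calc |u x| * |v x| ≤ (C * (1 + |x|) ^ k) * (D * (1 + |x|) ^ l) :=
        mul_le_mul (h x) (h' x) (abs_nonneg _) (by positivity)
    _ = _ := by ring

lemma polyBounded_const (c : ℝ) : PolyBounded (fun _ => c) :=
  ⟨|c|, 0, abs_nonneg c, fun x => by simp⟩

/-- `u` is `n` times differentiable and its derivatives up to order `n` are polynomially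
bounded. -/
def PolyGrowth : ℕ → (ℝ → ℝ) → Prop
  | 0, u => PolyBounded u
  | n + 1, u => Differentiable ℝ u ∧ PolyBounded u ∧ PolyGrowth n (deriv u)

lemma PolyGrowth.polyBounded {n : ℕ} {u : ℝ → ℝ} (h : PolyGrowth n u) : PolyBounded u := by
  cases n with
  | zero => exact h
  | succ n => exact h.2.1

lemma PolyGrowth.of_succ {n : ℕ} {u : ℝ → ℝ} (h : PolyGrowth (n + 1) u) : PolyGrowth n u := by
  induction n generalizing u with
  | zero => exact h.2.1
  | succ n ih => exact ⟨h.1, h.2.1, ih h.2.2⟩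

lemma polyGrowth_const (n : ℕ) (c : ℝ) : PolyGrowth n (fun _ => c) := by
  induction n generalizing c with
  | zero => exact polyBounded_const c
  | succ n ih => exact ⟨differentiable_const c, polyBounded_const c, by simpa using ih 0⟩

lemma PolyGrowth.add {n : ℕ} {u v : ℝ → ℝ} (hu : PolyGrowth n u) (hv : PolyGrowth n v) :
    PolyGrowth n (fun x => u x + v x) := by
  induction n generalizing u v with
  | zero => exact PolyBounded.add hu hv
  | succ n ih =>
    refine ⟨hu.1.fun_add hv.1, hu.2.1.add hv.2.1, ?_⟩
    have : deriv (fun x => u x + v x) = fun x => deriv u x + deriv v x :=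
      funext fun x => deriv_fun_add (hu.1 x) (hv.1 x)
    rw [this]
    exact ih hu.2.2 hv.2.2

lemma PolyGrowth.mul {n : ℕ} {u v : ℝ → ℝ} (hu : PolyGrowth n u) (hv : PolyGrowth n v) :
    PolyGrowth n (fun x => u x * v x) := by
  induction n generalizing u v with
  | zero => exact PolyBounded.mul hu hv
  | succ n ih =>
    refine ⟨hu.1.fun_mul hv.1, hu.2.1.mul hv.2.1, ?_⟩
    have : deriv (fun x => u x * v x) = fun x => deriv u x * v x + u x * deriv v x :=
      funext fun x => deriv_fun_mul (hu.1 x) (hv.1 x)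
    rw [this]
    exact (ih hu.2.2 hv.of_succ).add (ih hu.of_succ hv.2.2)

lemma PolyGrowth.const_mul {n : ℕ} {u : ℝ → ℝ} (c : ℝ) (hu : PolyGrowth n u) :
    PolyGrowth n (fun x => c * u x) :=
  (polyGrowth_const n c).mul hu

lemma polyGrowth_succ_of_hasDerivAt {n : ℕ} {u v : ℝ → ℝ} (hd : ∀ x, HasDerivAt u (v x) x)
    (hu : PolyBounded u) (hv : PolyGrowth n v) : PolyGrowth (n + 1) u := by
  refine ⟨fun x => (hd x).differentiableAt, hu, ?_⟩
  rwa [funext fun x => (hd x).deriv]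

lemma PolyGrowth.contDiff {n : ℕ} {u : ℝ → ℝ} (h : PolyGrowth (n + 1) u) : ContDiff ℝ n u := by
  induction n generalizing u with
  | zero => exact contDiff_zero.2 h.1.continuous
  | succ n ih =>
    push_cast
    exact contDiff_succ_iff_deriv.2 ⟨h.1, by simp, ih h.2.2⟩

lemma polyGrowth_tanhTwo (n : ℕ) : PolyGrowth n tanhTwo := by
  have hb : PolyBounded tanhTwo := ⟨1, 0, zero_le_one, fun x => by simpa using abs_tanhTwo_le_one x⟩
  induction n with
  | zero => exact hb
  | succ n ih =>
    refine polyGrowth_succ_of_hasDerivAt hasDerivAt_tanhTwo hb ?_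
    have := (((ih.mul ih).const_mul (-1)).add (polyGrowth_const n 1)).const_mul 2
    convert this using 3
    ring

/-- Solutions of a first order linear equation inherit polynomial growth of all derivatives
from the coefficients. -/
lemma polyGrowth_of_linear_ode {a b w : ℝ → ℝ} (ha : ∀ n, PolyGrowth n a)
    (hb : ∀ n, PolyGrowth n b) (hw : PolyBounded w)
    (hd : ∀ x, HasDerivAt w (a x * w x + b x) x) (n : ℕ) : PolyGrowth n w := by
  induction n with
  | zero => exact hw
  | succ n ih => exact polyGrowth_succ_of_hasDerivAt hd hw (((ha n).mul ih).add (hb n))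

lemma polyBounded_integral {w : ℝ → ℝ} (hw : PolyBounded w) :
    PolyBounded (fun x => ∫ y in (0 : ℝ)..x, w y) := by
  obtain ⟨C, k, hC, h⟩ := hw
  refine ⟨C, k + 1, hC, fun x => ?_⟩
  have := intervalIntegral.norm_integral_le_of_norm_le_const (a := 0) (b := x) (f := w)
    (C := C * (1 + |x|) ^ k) (fun y hy => by
      have hyx : |y| ≤ |x| := by
        rcases Set.mem_uIoc.1 hy with h | h
        · rw [abs_of_pos h.1]
          exact h.2.trans (le_abs_self x)
        · rw [abs_of_nonpos h.2, abs_of_neg (h.1.trans_le h.2)]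
          linarith [h.1]
      exact (h y).trans (by gcongr))
  rw [Real.norm_eq_abs, sub_zero] at this
  calc _ ≤ C * (1 + |x|) ^ k * |x| := this
    _ ≤ C * (1 + |x|) ^ k * (1 + |x|) := by gcongr; linarith
    _ = _ := by ring

end PolynomialGrowth

section ClassY

lemma polyBounded_div_Q {u : ℝ → ℝ}
    (h : ∃ C κ : ℝ, 0 < C ∧ 0 < κ ∧ ∀ x, |u x| ≤ C * (1 + |x|) ^ κ * Q x) :
    PolyBounded (fun x => u x / Q x) := by
  obtain ⟨C, κ, hC, -, h⟩ := h
  refine ⟨C, ⌈κ⌉₊, hC.le, fun x => ?_⟩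
  rw [abs_div, abs_of_pos (Q_pos x), div_le_iff₀ (Q_pos x)]
  refine (h x).trans ?_
  have : (1 + |x|) ^ κ ≤ (1 + |x|) ^ ⌈κ⌉₊ := by
    rw [← rpow_natCast]
    exact rpow_le_rpow_of_exponent_le (by linarith [abs_nonneg x]) (Nat.le_ceil κ)
  have := (Q_pos x).le
  gcongr

lemma hasDerivAt_div_Q {u : ℝ → ℝ} {u' x : ℝ} (hu : HasDerivAt u u' x) :
    HasDerivAt (fun y => u y / Q y) (u' / Q x + tanhTwo x * (u x / Q x)) x := by
  have h := (Q_pos x).ne'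
  refine (hu.fun_div (hasDerivAt_Q x) h).congr_deriv ?_
  field_simp
  ring

lemma polyGrowth_div_Q {u : ℝ → ℝ} (hu : ContDiff ℝ (⊤ : ℕ∞) u)
    (h : ∀ k : ℕ, ∃ C κ : ℝ, 0 < C ∧ 0 < κ ∧
      ∀ x : ℝ, |iteratedDeriv k u x| ≤ C * (1 + |x|) ^ κ * Q x) (n : ℕ) :
    PolyGrowth n (fun x => u x / Q x) := by
  induction n generalizing u with
  | zero => exact polyBounded_div_Q (by simpa using h 0)
  | succ n ih =>
    have hu' := contDiff_infty_iff_deriv.1 hu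
    refine polyGrowth_succ_of_hasDerivAt
      (fun x => hasDerivAt_div_Q (hu'.1 x).hasDerivAt) (polyBounded_div_Q (by simpa using h 0)) ?_
    refine (ih hu'.2 fun k => ?_).add ((polyGrowth_tanhTwo n).mul (ih hu h))
    simpa [iteratedDeriv_succ'] using h (k + 1)

lemma hasDerivAt_Q_mul {u : ℝ → ℝ} {u' x : ℝ} (hu : HasDerivAt u u' x) :
    HasDerivAt (fun y => Q y * u y) (Q x * (u' - tanhTwo x * u x)) x :=
  ((hasDerivAt_Q x).fun_mul hu).congr_deriv (by ring)

lemma iteratedDeriv_Q_mul {n : ℕ} {u : ℝ → ℝ} (hu : PolyGrowth n u) :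
    ∃ v, PolyBounded v ∧ iteratedDeriv n (fun x => Q x * u x) = fun x => Q x * v x := by
  induction n generalizing u with
  | zero => exact ⟨u, hu, by simp⟩
  | succ n ih =>
    rw [iteratedDeriv_succ', funext fun x => (hasDerivAt_Q_mul (hu.1 x).hasDerivAt).deriv]
    apply ih
    have := hu.2.2.add (((polyGrowth_tanhTwo n).mul hu.of_succ).const_mul (-1))
    convert this using 2
    ring

lemma contDiff_of_polyGrowth {u : ℝ → ℝ} (hu : ∀ n, PolyGrowth n u) : ContDiff ℝ (⊤ : ℕ∞) u :=
  contDiff_infty.2 fun n => (hu (n + 1)).contDiff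

lemma contDiff_Q : ContDiff ℝ (⊤ : ℕ∞) Q := by
  have h (x : ℝ) : 1 / cosh (2 * x) ≠ 0 := (one_div_pos.2 (cosh_pos _)).ne'
  have hc : ContDiff ℝ (⊤ : ℕ∞) fun x : ℝ => 1 / cosh (2 * x) :=
    contDiff_const.div ((contDiff_const.mul contDiff_id).cosh) fun x => (cosh_pos _).ne'
  exact contDiff_const.mul (hc.rpow_const_of_ne h)

lemma memY_Q_mul {u : ℝ → ℝ} (heven : ∀ x, u (-x) = u x) (hu : ∀ n, PolyGrowth n u) :
    MemY (fun x => Q x * u x) := by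
  refine ⟨fun x => by simp only [Q_neg, heven], contDiff_Q.mul (contDiff_of_polyGrowth hu), fun k => ?_⟩
  obtain ⟨v, ⟨C, m, hC, hv⟩, h⟩ := iteratedDeriv_Q_mul (hu k)
  refine ⟨C + 1, m + 1, by positivity, by positivity, fun x => ?_⟩
  rw [h, abs_mul, abs_of_pos (Q_pos x), mul_comm]
  refine mul_le_mul_of_nonneg_right ((hv x).trans ?_) (Q_pos x).le
  have h1 : (1 : ℝ) ≤ 1 + |x| := by linarith [abs_nonneg x]
  have : (1 + |x|) ^ ((m : ℝ) + 1) = (1 + |x|) ^ (m + 1) := by exact_mod_cast rpow_natCast _ (m + 1)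
  rw [this]
  exact mul_le_mul (by linarith) (pow_le_pow_right₀ h1 (by omega)) (by positivity) (by positivity)

end ClassY

section Primitive

lemma one_add_pow_mul_exp_le (k : ℕ) {x y : ℝ} (hx : 0 ≤ x) (hy : x ≤ y) :
    (1 + y) ^ k * exp (-2 * y) ≤ k.factorial * exp 1 * (1 + x) ^ k * exp (-x) * exp (-y) := by
  have h1 : (1 + y) ^ k ≤ (1 + x) ^ k * (1 + (y - x)) ^ k := by
    rw [← mul_pow]
    exact pow_le_pow_left₀ (by linarith) (by nlinarith) k
  have h2 : (1 + (y - x)) ^ k ≤ exp (1 + (y - x)) * k.factorial :=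
    (div_le_iff₀ (by positivity)).1 (pow_div_factorial_le_exp (1 + (y - x)) (by linarith) k)
  have h3 : exp (1 + (y - x)) * exp (-2 * y) = exp 1 * exp (-x) * exp (-y) := by
    simp only [← exp_add]
    ring_nf
  calc (1 + y) ^ k * exp (-2 * y)
      ≤ (1 + x) ^ k * (exp (1 + (y - x)) * k.factorial) * exp (-2 * y) := by
        gcongr
        exact h1.trans (by gcongr)
    _ = (1 + x) ^ k * k.factorial * (exp (1 + (y - x)) * exp (-2 * y)) := by ring
    _ = _ := by rw [h3]; ring

/-- The primitive of a function of mean zero on the half-line which decays like `Q ^ 2`, up to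
polynomial factors, decays in the same way. -/
lemma abs_integral_le_of_integral_Ioi_eq_zero {F : ℝ → ℝ} (hF : Continuous F) {C : ℝ} {k : ℕ}
    (hC : 0 ≤ C) (hb : ∀ y, 0 ≤ y → |F y| ≤ C * (1 + y) ^ k * Q y ^ 2)
    (h0 : ∫ y in Set.Ioi 0, F y = 0) {x : ℝ} (hx : 0 ≤ x) :
    |∫ y in (0 : ℝ)..x, F y| ≤
      C * (√3 * 2) * (k.factorial * exp 1) * (1 + x) ^ k * Q x ^ 2 := by
  set M : ℝ := C * (√3 * 2) * (k.factorial * exp 1)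
  have hM : 0 ≤ M := by positivity
  have hpt {z y : ℝ} (hz : 0 ≤ z) (hy : z ≤ y) :
      ‖F y‖ ≤ M * (1 + z) ^ k * exp (-z) * exp (-y) := by
    have hy0 : 0 ≤ y := hz.trans hy
    calc |F y| ≤ C * (1 + y) ^ k * (√3 * 2 * exp (-2 * y)) :=
          (hb y hy0).trans (by gcongr; exact Q_sq_le y)
      _ = C * (√3 * 2) * ((1 + y) ^ k * exp (-2 * y)) := by ring
      _ ≤ C * (√3 * 2) * (k.factorial * exp 1 * (1 + z) ^ k * exp (-z) * exp (-y)) := by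
          exact mul_le_mul_of_nonneg_left (one_add_pow_mul_exp_le k hz hy) (by positivity)
      _ = _ := by simp only [M]; ring
  have hexp (z : ℝ) (c : ℝ) : IntegrableOn (fun y => c * exp (-y)) (Set.Ioi z) :=
    (integrableOn_exp_neg_Ioi z).const_mul c
  have hae {z : ℝ} (hz : 0 ≤ z) : ∀ᵐ y ∂volume.restrict (Set.Ioi z),
      ‖F y‖ ≤ M * (1 + z) ^ k * exp (-z) * exp (-y) :=
    (ae_restrict_mem measurableSet_Ioi).mono fun y hy => hpt hz (le_of_lt hy)
  have hint {z : ℝ} (hz : 0 ≤ z) : IntegrableOn F (Set.Ioi z) :=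
    (hexp z _).mono' hF.aestronglyMeasurable (hae hz)
  have hsplit := intervalIntegral.integral_interval_add_Ioi (hint le_rfl) (hint hx)
  rw [h0] at hsplit
  rw [eq_neg_of_add_eq_zero_left hsplit, abs_neg]
  calc |∫ y in Set.Ioi x, F y|
      ≤ ∫ y in Set.Ioi x, M * (1 + x) ^ k * exp (-x) * exp (-y) :=
        norm_integral_le_of_norm_le (hexp x _) (hae hx)
    _ = M * (1 + x) ^ k * exp (-2 * x) := by
        rw [integral_const_mul, integral_exp_neg_Ioi, mul_assoc, ← exp_add]
        ring_nf
    _ ≤ M * (1 + x) ^ k * Q x ^ 2 := by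
        gcongr
        exact exp_le_Q_sq hx

lemma integral_zero_neg_of_even {F : ℝ → ℝ} (hF : ∀ x, F (-x) = F x) (x : ℝ) :
    ∫ y in (0 : ℝ)..-x, F y = -∫ y in (0 : ℝ)..x, F y := by
  have := intervalIntegral.integral_comp_neg (a := 0) (b := x) F
  simp only [hF, neg_zero] at this
  rw [intervalIntegral.integral_symm, this]

lemma integral_zero_neg_of_odd {F : ℝ → ℝ} (hF : ∀ x, F (-x) = -F x) (x : ℝ) :
    ∫ y in (0 : ℝ)..-x, F y = ∫ y in (0 : ℝ)..x, F y := by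
  have := intervalIntegral.integral_comp_neg (a := 0) (b := x) F
  simp only [hF, neg_zero, intervalIntegral.integral_neg] at this
  rw [intervalIntegral.integral_symm, ← this, neg_neg]

lemma integral_Ioi_eq_zero_of_even {F : ℝ → ℝ} (hF : ∀ x, F (-x) = F x) (h : ∫ x, F x = 0) :
    ∫ x in Set.Ioi 0, F x = 0 := by
  have habs : (fun x => F |x|) = F := by
    ext x
    rcases abs_choice x with hx | hx <;> simp [hx, hF]
  have := integral_comp_abs (f := F)
  rw [habs, h] at this
  linarith

/-- The derivative of `f / Q`, where `f` is the solution of `L₋ f = g` regular at infinity. -/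
lemma polyBounded_primitive_div_Q_sq {g : ℝ → ℝ} (hg : MemY g) (horth : ∫ x, g x * Q x = 0) :
    PolyBounded (fun x => -(∫ y in (0 : ℝ)..x, g y * Q y) / Q x ^ 2) := by
  obtain ⟨heven, hsmooth, hbd⟩ := hg
  have hF : ∀ x, g (-x) * Q (-x) = g x * Q x := fun x => by rw [heven, Q_neg]
  obtain ⟨C, k, hC, hb⟩ := polyBounded_div_Q (u := g) (by simpa using hbd 0)
  have key {x : ℝ} (hx : 0 ≤ x) := abs_integral_le_of_integral_Ioi_eq_zero
    (F := fun y => g y * Q y) (k := k) (hsmooth.continuous.mul differentiable_Q.continuous) hC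
    (fun y hy => by
      have := hb y
      rw [abs_div, abs_of_pos (Q_pos y), div_le_iff₀ (Q_pos y), abs_of_nonneg hy] at this
      rw [abs_mul, abs_of_pos (Q_pos y), pow_two (Q y), ← mul_assoc]
      exact mul_le_mul_of_nonneg_right this (Q_pos y).le)
    (integral_Ioi_eq_zero_of_even hF horth) hx
  refine ⟨C * (√3 * 2) * (k.factorial * exp 1), k, by positivity, fun x => ?_⟩
  rw [abs_div, abs_neg, abs_of_pos (pow_pos (Q_pos x) 2), div_le_iff₀ (pow_pos (Q_pos x) 2)]
  rcases le_total 0 x with hx | hx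
  · simpa only [abs_of_nonneg hx] using key hx
  · have := key (neg_nonneg.2 hx)
    rwa [integral_zero_neg_of_even hF, abs_neg, Q_neg, ← abs_of_nonpos hx] at this

end Primitive

/-- Solvability of `L₋`: for every `g ∈ 𝒴` orthogonal to `Q` there is `f ∈ 𝒴` with
`L₋ f = −f'' + f − Q⁴f = g`. -/
theorem Lminus_solvable (g : ℝ → ℝ) (hg : MemY g)
    (horth : (∫ x : ℝ, g x * Q x) = 0) :
    ∃ f : ℝ → ℝ, MemY f ∧
      ∀ x : ℝ, -(deriv (deriv f) x) + f x - (Q x) ^ 4 * f x = g x := by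
  have hwb := polyBounded_primitive_div_Q_sq hg horth
  obtain ⟨heven, hsmooth, hbd⟩ := hg
  have hcont : Continuous fun y => g y * Q y :=
    hsmooth.continuous.mul differentiable_Q.continuous
  set w : ℝ → ℝ := fun x => -(∫ y in (0 : ℝ)..x, g y * Q y) / Q x ^ 2 with hw
  have hwd (x : ℝ) : HasDerivAt w (2 * tanhTwo x * w x + -1 * (g x / Q x)) x := by
    have hQ := (Q_pos x).ne'
    have hI := intervalIntegral.integral_hasDerivAt_right (hcont.intervalIntegrable 0 x)
      (hcont.stronglyMeasurableAtFilter _ _) hcont.continuousAt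
    refine (hI.fun_neg.fun_div ((hasDerivAt_Q x).fun_pow 2) (pow_ne_zero 2 hQ)).congr_deriv ?_
    simp only [hw]
    field_simp
    ring
  have hwp : ∀ n, PolyGrowth n w := polyGrowth_of_linear_ode
    (fun n => (polyGrowth_tanhTwo n).const_mul 2)
    (fun n => (polyGrowth_div_Q hsmooth hbd n).const_mul (-1)) hwb hwd
  have hwc : Continuous w := (hwp 1).1.continuous
  have hwodd (x : ℝ) : w (-x) = -w x := by
    simp only [hw]
    rw [integral_zero_neg_of_even (F := fun y => g y * Q y)
      (fun x => by rw [heven, Q_neg]), Q_neg]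
    ring
  set h : ℝ → ℝ := fun x => ∫ y in (0 : ℝ)..x, w y
  have hhd (x : ℝ) : HasDerivAt h (w x) x :=
    intervalIntegral.integral_hasDerivAt_right (hwc.intervalIntegrable 0 x)
      (hwc.stronglyMeasurableAtFilter _ _) hwc.continuousAt
  have hhp (n : ℕ) : PolyGrowth n h :=
    (polyGrowth_succ_of_hasDerivAt hhd (polyBounded_integral hwb) (hwp n)).of_succ
  refine ⟨fun x => Q x * h x, memY_Q_mul (integral_zero_neg_of_odd hwodd) hhp, fun x => ?_⟩
  rw [funext fun x => (hasDerivAt_Q_mul (hhd x)).deriv,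
    (hasDerivAt_Q_mul ((hwd x).fun_sub ((hasDerivAt_tanhTwo x).fun_mul (hhd x)))).deriv,
    Q_pow_four]
  have hQ := (Q_pos x).ne'
  field_simp
  ring
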